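/- arXiv:2507.15215 — 3 statements merged into one kernel-verified Lean document; each statement's English description precedes it below -/
import Mathlib

section
/- (Feasibility of the optimal pair, Theorem 5(a) in Laplace-principle form.) Under the general setting with Assumption 1, the pair (X*, u*) is feasible: X* : Z → X and u* : Z → ℝ are continuous, and for every θ ∈ Θ, sup_{z∈Z} { ℓ( R(X*(z), θ) − u*(z) ) − I_θ(z) } ≤ −r, with the convention that the expression inside the supremum equals −∞ when I_θ(z) = ∞. -/
open Filter Topology Set
open scoped ENNReal Classical

noncomputable section

/-- The regret `R(x,θ) := c(x,θ) − min_{y∈X} c(y,θ)`. -/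
def regretFn {E Θ : Type*} (c : E → Θ → ℝ) (X : Set E) (x : E) (θ : Θ) : ℝ :=
  c x θ - sInf ((fun y => c y θ) '' X)

/-- The inner expression `R(x,θ) − ℓ⁻¹(I_θ(z) − r)` as an extended real number,
with the convention that it equals `−∞` whenever `I_θ(z) = ∞`. -/
def innerFn {E Θ Z : Type*} (c : E → Θ → ℝ) (X : Set E) (linv : ℝ → ℝ) (r : ℝ)
    (I : Θ → Z → ℝ≥0∞) (x : E) (θ : Θ) (z : Z) : EReal :=
  if I θ z = ∞ then ⊥
  else ((regretFn c X x θ - linv ((I θ z).toReal - r) : ℝ) : EReal)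

/-- `G(x,z) := max_{θ∈Θ} { R(x,θ) − ℓ⁻¹(I_θ(z) − r) }` as a real number. -/
def Gfn {E Θ Z : Type*} (c : E → Θ → ℝ) (X : Set E) (linv : ℝ → ℝ) (r : ℝ)
    (I : Θ → Z → ℝ≥0∞) (x : E) (z : Z) : ℝ :=
  (⨆ θ : Θ, innerFn c X linv r I x θ z).toReal

/-- `u*(z) := min_{x∈X} G(x,z)`. -/
def ustarFn {E Θ Z : Type*} (c : E → Θ → ℝ) (X : Set E) (linv : ℝ → ℝ) (r : ℝ)
    (I : Θ → Z → ℝ≥0∞) (z : Z) : ℝ :=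
  sInf ((fun x => Gfn c X linv r I x z) '' X)

theorem continuous_of_unique_minimizer {K Z : Type*} [TopologicalSpace K] [CompactSpace K]
    [TopologicalSpace Z] (g : K × Z → ℝ) (hg : Continuous g) (s : Z → K)
    (hs : ∀ z x, x ≠ s z → g (s z, z) < g (x, z)) : Continuous s := by
  rw [continuous_iff_continuousAt]
  intro z
  rw [ContinuousAt, tendsto_nhds]
  intro U hU hzU
  have hK : IsCompact Uᶜ := hU.isClosed_compl.isCompact
  have key : ∀ᶠ z' in 𝓝 z, ∀ x ∈ Uᶜ, g (s z, z') < g (x, z') := by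
    refine hK.eventually_forall_of_forall_eventually fun x hx => ?_
    have hne : x ≠ s z := fun h => hx (h ▸ hzU)
    have h1 : Continuous fun p : Z × K => g (s z, p.1) := by fun_prop
    have h2 : Continuous fun p : Z × K => g (p.2, p.1) := by fun_prop
    exact h1.continuousAt.eventually_lt h2.continuousAt (hs z x hne)
  filter_upwards [key] with z' hz'
  by_contra hcon
  have h1 := hz' (s z') hcon
  by_cases h : s z = s z'
  · rw [h] at h1
    exact lt_irrefl _ h1
  · exact lt_asymm h1 (hs z' (s z) h)

section

variable {E Θ Z : Type*} {c : E → Θ → ℝ} {X : Set E} {ℓ linv : ℝ → ℝ} {r : ℝ}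
  {I : Θ → Z → ℝ≥0∞}

theorem innerFn_of_ne_top {θ : Θ} {z : Z} (x : E) (h : I θ z ≠ ∞) :
    innerFn c X linv r I x θ z
      = ((regretFn c X x θ - linv ((I θ z).toReal - r) : ℝ) : EReal) := by
  simp [innerFn, h]

theorem innerFn_lt_coe_iff (hℓ : StrictMono ℓ) (hlinv : ∀ y, ℓ (linv y) = y)
    (x : E) (θ : Θ) (z : Z) (y : ℝ) :
    innerFn c X linv r I x θ z < (y : EReal) ↔
      ENNReal.ofReal (ℓ (regretFn c X x θ - y) + r) < I θ z ∨
        ℓ (regretFn c X x θ - y) + r < 0 := by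
  by_cases h : I θ z = ∞
  · simp [innerFn, h]
  · rw [innerFn_of_ne_top x h, EReal.coe_lt_coe_iff, sub_lt_comm, ← hℓ.lt_iff_lt, hlinv,
      lt_sub_iff_add_lt]
    have h0 : 0 ≤ (I θ z).toReal := ENNReal.toReal_nonneg
    rcases lt_or_ge (ℓ (regretFn c X x θ - y) + r) 0 with hneg | hpos
    · exact iff_of_true (hneg.trans_le h0) (Or.inr hneg)
    · rw [ENNReal.ofReal_lt_iff_lt_toReal hpos h]
      simp [not_lt.2 hpos]

theorem continuous_regretFn [TopologicalSpace E] [TopologicalSpace Θ] (hX : IsCompact X)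
    (hc : ContinuousOn (fun p : E × Θ => c p.1 p.2) (X ×ˢ univ)) :
    Continuous fun p : X × Θ => regretFn c X p.1 p.2 := by
  have hc' : Continuous fun p : X × Θ => c p.1 p.2 :=
    hc.comp_continuous (f := fun p : X × Θ => ((p.1 : E), p.2)) (by fun_prop) (by simp)
  have : CompactSpace X := isCompact_iff_compactSpace.1 hX
  have hmin : Continuous fun θ : Θ => sInf ((fun y : X => c y θ) '' univ) :=
    isCompact_univ.continuous_sInf (f := fun (θ : Θ) (y : X) => c y θ)
      (hc'.comp continuous_swap)
  have heq : ∀ θ, (fun y : X => c y θ) '' univ = (fun y => c y θ) '' X := by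
    intro θ
    ext
    simp
  simp only [heq] at hmin
  exact hc'.sub (hmin.comp continuous_snd)

theorem eventually_innerFn_lt [TopologicalSpace E] [TopologicalSpace Θ] [TopologicalSpace Z]
    (hR : Continuous fun p : X × Θ => regretFn c X p.1 p.2)
    (hℓcont : Continuous ℓ) (hℓ : StrictMono ℓ) (hlinv : ∀ y, ℓ (linv y) = y)
    (hI : LowerSemicontinuous fun p : Θ × Z => I p.1 p.2)
    {x : X} {z : Z} {θ : Θ} {y : ℝ} (h : innerFn c X linv r I x θ z < y) :
    ∀ᶠ p : (X × Z) × Θ in 𝓝 ((x, z), θ), innerFn c X linv r I p.1.1 p.2 p.1.2 < y := by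
  simp only [innerFn_lt_coe_iff hℓ hlinv] at h ⊢
  have hcont : Continuous fun p : (X × Z) × Θ => ℓ (regretFn c X p.1.1 p.2 - y) + r := by
    have : Continuous fun p : (X × Z) × Θ => regretFn c X p.1.1 p.2 :=
      hR.comp (f := fun p : (X × Z) × Θ => (p.1.1, p.2)) (by fun_prop)
    fun_prop
  rcases h with h | h
  · obtain ⟨m, hm1, hm2⟩ := exists_between h
    have e1 : ∀ᶠ p : (X × Z) × Θ in 𝓝 ((x, z), θ), m < I p.2 p.1.2 := by
      have hproj : Continuous fun p : (X × Z) × Θ => (p.2, p.1.2) := by fun_prop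
      exact (hproj.tendsto ((x, z), θ)).eventually (hI (θ, z) m hm2)
    have e2 : ∀ᶠ p : (X × Z) × Θ in 𝓝 ((x, z), θ),
        ENNReal.ofReal (ℓ (regretFn c X p.1.1 p.2 - y) + r) < m :=
      (ENNReal.continuous_ofReal.comp hcont).continuousAt.eventually_lt_const hm1
    filter_upwards [e1, e2] with p h1 h2
    exact Or.inl (h2.trans h1)
  · filter_upwards [hcont.continuousAt.eventually_lt_const h] with p hp
    exact Or.inr hp

theorem exists_Gfn_eq [TopologicalSpace Θ] [CompactSpace Θ] {x : E} {z : Z}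
    (husc : UpperSemicontinuous fun θ => innerFn c X linv r I x θ z)
    (hz : ∃ θ, I θ z ≠ ∞) :
    ∃ θ, I θ z ≠ ∞ ∧
      Gfn c X linv r I x z = regretFn c X x θ - linv ((I θ z).toReal - r) ∧
      ∀ θ', I θ' z ≠ ∞ →
        regretFn c X x θ' - linv ((I θ' z).toReal - r) ≤ Gfn c X linv r I x z := by
  obtain ⟨θ₁, h₁⟩ := hz
  obtain ⟨θ₀, -, hmax⟩ := (husc.upperSemicontinuousOn univ).exists_isMaxOn
    ⟨θ₁, mem_univ _⟩ isCompact_univ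
  have hle : ∀ θ, innerFn c X linv r I x θ z ≤ innerFn c X linv r I x θ₀ z :=
    fun θ => hmax (mem_univ θ)
  have h₀ : I θ₀ z ≠ ∞ := by
    intro htop
    have := hle θ₁
    rw [innerFn_of_ne_top x h₁, innerFn, if_pos htop] at this
    exact EReal.coe_ne_bot _ (le_bot_iff.1 this)
  have hG : Gfn c X linv r I x z = regretFn c X x θ₀ - linv ((I θ₀ z).toReal - r) := by
    rw [Gfn, le_antisymm (iSup_le hle) (le_iSup (fun θ => innerFn c X linv r I x θ z) θ₀),
      innerFn_of_ne_top x h₀, EReal.toReal_coe]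
  refine ⟨θ₀, h₀, hG, fun θ' h' => ?_⟩
  have := hle θ'
  rw [innerFn_of_ne_top x h', innerFn_of_ne_top x h₀, EReal.coe_le_coe_iff] at this
  rwa [hG]

theorem Gfn_midpoint_lt [AddCommGroup E] [Module ℝ E] [TopologicalSpace Θ] [CompactSpace Θ]
    (hc : ∀ θ : Θ, StrictConvexOn ℝ X fun x => c x θ) {z : Z} (hz : ∃ θ, I θ z ≠ ∞)
    (husc : ∀ x ∈ X, UpperSemicontinuous fun θ => innerFn c X linv r I x θ z)
    {x y : E} (hx : x ∈ X) (hy : y ∈ X) (hxy : x ≠ y) :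
    Gfn c X linv r I ((1 / 2 : ℝ) • x + (1 / 2 : ℝ) • y) z
      < (Gfn c X linv r I x z + Gfn c X linv r I y z) / 2 := by
  obtain ⟨θ₁, -⟩ := id hz
  have hm := (hc θ₁).1 hx hy (by norm_num : (0 : ℝ) ≤ 1 / 2) (by norm_num : (0 : ℝ) ≤ 1 / 2)
    (by norm_num)
  obtain ⟨θ, hθ, hG, -⟩ := exists_Gfn_eq (husc _ hm) hz
  obtain ⟨-, -, -, h1⟩ := exists_Gfn_eq (husc _ hx) hz
  obtain ⟨-, -, -, h2⟩ := exists_Gfn_eq (husc _ hy) hz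
  have hlt := (hc θ).2 hx hy hxy (by norm_num : (0 : ℝ) < 1 / 2) (by norm_num : (0 : ℝ) < 1 / 2)
    (by norm_num)
  have h1 := h1 θ hθ
  have h2 := h2 θ hθ
  rw [hG]
  simp only [regretFn, smul_eq_mul] at h1 h2 hlt ⊢
  linarith

end

/-- Theorem 5(a), Laplace-principle form: the optimal pair `(X*, u*)` is
feasible: both are continuous, and for every `θ ∈ Θ`,
`sup_{z∈Z} { ℓ(R(X*(z),θ) − u*(z)) − I_θ(z) } ≤ −r`, the expression inside the
supremum being `−∞` when `I_θ(z) = ∞`. -/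
theorem optimal_pair_feasible
    {E Θ Z : Type*} [NormedAddCommGroup E] [NormedSpace ℝ E]
    [MetricSpace Θ] [CompactSpace Θ] [Nonempty Θ]
    [MetricSpace Z] [Nonempty Z]
    (X : Set E) (hXcomp : IsCompact X) (hXconv : Convex ℝ X) (hXne : X.Nonempty)
    (c : E → Θ → ℝ)
    (hc : ContinuousOn (fun p : E × Θ => c p.1 p.2) (X ×ˢ univ))
    (hcconv : ∀ θ : Θ, StrictConvexOn ℝ X fun x => c x θ)
    (ℓ : ℝ → ℝ) (hℓcont : Continuous ℓ) (hℓmono : StrictMono ℓ)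
    (hℓbij : Function.Bijective ℓ) (hℓ0 : ℓ 0 = 0)
    (linv : ℝ → ℝ) (hlinv : ∀ y, ℓ (linv y) = y) (hlinv' : ∀ y, linv (ℓ y) = y)
    (r : ℝ) (hr : 0 < r)
    (I : Θ → Z → ℝ≥0∞)
    (hI1 : ∀ z : Z, ∃ θ : Θ, I θ z ≠ ∞)
    (hI2 : LowerSemicontinuous fun p : Θ × Z => I p.1 p.2)
    (hI3 : ∀ (θ : Θ) (z : Z), I θ z ≠ ∞ → ∀ zs : ℕ → Z, Tendsto zs atTop (𝓝 z) →
      ∃ θs : ℕ → Θ, Tendsto θs atTop (𝓝 θ) ∧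
        Tendsto (fun n => I (θs n) (zs n)) atTop (𝓝 (I θ z)))
    (Xstar : Z → E)
    (hXstar : ∀ z : Z, Xstar z ∈ X ∧
      ∀ y ∈ X, Gfn c X linv r I (Xstar z) z ≤ Gfn c X linv r I y z) :
    Continuous Xstar ∧ Continuous (ustarFn c X linv r I) ∧
    ∀ θ : Θ,
      (⨆ z : Z, if I θ z = ∞ then (⊥ : EReal)
        else ((ℓ (regretFn c X (Xstar z) θ - ustarFn c X linv r I z)
                - (I θ z).toReal : ℝ) : EReal))
        ≤ ((-r : ℝ) : EReal) := by
  have : CompactSpace X := isCompact_iff_compactSpace.1 hXcomp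
  have hR := continuous_regretFn hXcomp hc
  have hlinvcont : Continuous linv := by
    have hmono : StrictMono linv := fun a b hab => by
      rw [← hℓmono.lt_iff_lt, hlinv, hlinv]
      exact hab
    exact hmono.monotone.continuous_of_surjective fun y => ⟨ℓ y, hlinv' y⟩
  have husc : ∀ z, ∀ x ∈ X, UpperSemicontinuous fun θ => innerFn c X linv r I x θ z := by
    intro z x hx θ y hy
    obtain ⟨q, hq1, hq2⟩ := EReal.lt_iff_exists_real_btwn.1 hy
    have hproj : Continuous fun θ : Θ => (((⟨x, hx⟩ : X), z), θ) := by fun_prop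
    filter_upwards [hproj.continuousAt.eventually
      (eventually_innerFn_lt (x := ⟨x, hx⟩) hR hℓcont hℓmono hlinv hI2 hq1)] with θ' h'
    exact h'.trans hq2
  have hG : ∀ z, ∀ x ∈ X, _ := fun z x hx => exists_Gfn_eq (husc z x hx) (hI1 z)
  have hGcont : Continuous fun p : X × Z => Gfn c X linv r I p.1 p.2 := by
    refine SeqContinuous.continuous fun ps p hps => tendsto_order.2 ⟨fun y hy => ?_, fun y hy => ?_⟩
    · obtain ⟨θ, hθ, hGθ, -⟩ := hG p.2 p.1 p.1.2
      obtain ⟨θs, hθs, hIs⟩ := hI3 θ p.2 hθ (fun n => (ps n).2)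
        ((continuous_snd.tendsto p).comp hps)
      have hreg : Tendsto (fun n => regretFn c X (ps n).1 (θs n)) atTop
          (𝓝 (regretFn c X p.1 θ)) :=
        (hR.tendsto (p.1, θ)).comp (((continuous_fst.tendsto p).comp hps).prodMk_nhds hθs)
      have hpen := (hlinvcont.tendsto _).comp (((ENNReal.tendsto_toReal hθ).comp hIs).sub_const r)
      have hlim := hreg.sub hpen
      rw [← hGθ] at hlim
      filter_upwards [hlim.eventually_const_lt hy, hIs.eventually_ne hθ] with n hn hfin
      obtain ⟨-, -, -, hle⟩ := hG (ps n).2 (ps n).1 (ps n).1.2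
      exact hn.trans_le (hle _ hfin)
    · obtain ⟨-, -, -, hle⟩ := hG p.2 p.1 p.1.2
      have hlt : ∀ θ, innerFn c X linv r I p.1 θ p.2 < (y : EReal) := by
        intro θ
        by_cases h : I θ p.2 = ∞
        · simp [innerFn, h]
        · rw [innerFn_of_ne_top _ h, EReal.coe_lt_coe_iff]
          exact (hle θ h).trans_lt hy
      have hev : ∀ᶠ q : X × Z in 𝓝 p, ∀ θ ∈ (univ : Set Θ),
          innerFn c X linv r I q.1 θ q.2 < (y : EReal) :=
        isCompact_univ.eventually_forall_of_forall_eventually fun θ _ =>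
          eventually_innerFn_lt hR hℓcont hℓmono hlinv hI2 (hlt θ)
      filter_upwards [hps.eventually hev] with n hn
      obtain ⟨θ, hθ, hGθ, -⟩ := hG (ps n).2 (ps n).1 (ps n).1.2
      have := hn θ (mem_univ θ)
      rw [innerFn_of_ne_top _ hθ, EReal.coe_lt_coe_iff] at this
      exact hGθ.trans_lt this
  have hu : ∀ z, ustarFn c X linv r I z = Gfn c X linv r I (Xstar z) z := by
    intro z
    refine IsLeast.csInf_eq ⟨mem_image_of_mem _ (hXstar z).1, ?_⟩
    rintro _ ⟨y, hy, rfl⟩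
    exact (hXstar z).2 y hy
  have hXcont : Continuous Xstar := by
    have hs := continuous_of_unique_minimizer _ hGcont (fun z => (⟨Xstar z, (hXstar z).1⟩ : X)) <| by
      rintro z ⟨x, hx⟩ hne
      have hne' : Xstar z ≠ x := fun h => hne (Subtype.ext h.symm)
      have hmid := Gfn_midpoint_lt hcconv (hI1 z) (husc z) (hXstar z).1 hx hne'
      have hmin := (hXstar z).2 _ (hXconv (hXstar z).1 hx (by norm_num : (0 : ℝ) ≤ 1 / 2)
        (by norm_num : (0 : ℝ) ≤ 1 / 2) (by norm_num))
      dsimp only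
      linarith
    exact continuous_subtype_val.comp hs
  refine ⟨hXcont, ?_, fun θ => iSup_le fun z => ?_⟩
  · rw [funext hu]
    exact hGcont.comp (f := fun z => ((⟨Xstar z, (hXstar z).1⟩ : X), z))
      ((hXcont.subtype_mk _).prodMk continuous_id)
  · split_ifs with h
    · exact bot_le
    · obtain ⟨-, -, -, hle⟩ := hG z (Xstar z) (hXstar z).1
      have hθ := hle θ h
      rw [EReal.coe_le_coe_iff, hu]
      have hmono := hℓmono.monotone
        (show regretFn c X (Xstar z) θ - Gfn c X linv r I (Xstar z) z
          ≤ linv ((I θ z).toReal - r) by linarith)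
      rw [hlinv] at hmono
      linarith

end
end

section
/- (Sufficient condition for consistency.) Under the general setting with Assumption 1, let Z_∞ : Θ → Z with I_θ(Z_∞(θ)) < ∞ for all θ, and define Γ(θ) := R(X*(Z_∞(θ)), θ). If for every θ ∈ Θ, min_{x∈X} max_{θ'∈Θ} { R(x,θ') − ℓ⁻¹(I_{θ'}(Z_∞(θ)) − r) } + ℓ⁻¹(I_θ(Z_∞(θ)) − r) = 0, then Γ(θ) = 0 for every θ ∈ Θ, i.e. X* is a strongly consistent solution. -/
open Filter Topology Set
open scoped ENNReal Classical

noncomputable section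

/-- The regret of a decision in `X` is nonnegative. -/
theorem regretFn_nonneg {E Θ : Type*} {c : E → Θ → ℝ} {X : Set E} {x : E} {θ : Θ}
    (hbdd : BddBelow ((fun y => c y θ) '' X)) (hx : x ∈ X) : 0 ≤ regretFn c X x θ :=
  sub_nonneg.2 (csInf_le hbdd (mem_image_of_mem _ hx))

/-- If the costs on `X` lie in `[m, M]`, then the regret is at most `M - m`. -/
theorem regretFn_le {E Θ : Type*} {c : E → Θ → ℝ} {X : Set E} {x : E} {θ : Θ} {m M : ℝ}
    (hm : ∀ y ∈ X, m ≤ c y θ) (hM : c x θ ≤ M) (hx : x ∈ X) : regretFn c X x θ ≤ M - m := by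
  refine sub_le_sub hM (le_csInf ⟨_, mem_image_of_mem _ hx⟩ ?_)
  rintro _ ⟨y, hy, rfl⟩
  exact hm y hy

/-- If the regret of `x` is bounded above and `linv` is monotone, then `Gfn` dominates the inner
expression at every parameter of finite rate. -/
theorem regretFn_sub_le_Gfn {E Θ Z : Type*} {c : E → Θ → ℝ} {X : Set E} {linv : ℝ → ℝ}
    (hlinv : Monotone linv) (r : ℝ) (I : Θ → Z → ℝ≥0∞) {x : E} {z : Z} {B : ℝ}
    (hB : ∀ θ, regretFn c X x θ ≤ B) {θ : Θ} (hθ : I θ z ≠ ∞) :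
    regretFn c X x θ - linv ((I θ z).toReal - r) ≤ Gfn c X linv r I x z := by
  have hle : ((regretFn c X x θ - linv ((I θ z).toReal - r) : ℝ) : EReal) ≤
      ⨆ θ, innerFn c X linv r I x θ z := by
    refine le_trans (le_of_eq ?_) (le_iSup (fun θ => innerFn c X linv r I x θ z) θ)
    simp only [innerFn, if_neg hθ]
  have hub : ⨆ θ, innerFn c X linv r I x θ z ≤ ((B - linv (-r) : ℝ) : EReal) := by
    refine iSup_le fun θ' => ?_
    unfold innerFn
    split_ifs
    · exact bot_le
    · have : linv (-r) ≤ linv ((I θ' z).toReal - r) :=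
        hlinv (by linarith [ENNReal.toReal_nonneg (a := I θ' z)])
      exact EReal.coe_le_coe_iff.2 (sub_le_sub (hB θ') this)
  have h := EReal.toReal_le_toReal hle (EReal.coe_ne_bot _)
    (ne_top_of_le_ne_top (EReal.coe_ne_top _) hub)
  rwa [EReal.toReal_coe] at h

/-- sufficient condition for consistency: if for every `θ ∈ Θ`,
`min_{x∈X} max_{θ'∈Θ} { R(x,θ') − ℓ⁻¹(I_{θ'}(Z_∞(θ)) − r) } + ℓ⁻¹(I_θ(Z_∞(θ)) − r) = 0`,
then the consistency gap `Γ(θ) := R(X*(Z_∞(θ)),θ)` vanishes for every `θ ∈ Θ`,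
i.e. `X*` is strongly consistent. -/
theorem consistency_sufficient_condition
    {E Θ Z : Type*} [NormedAddCommGroup E] [NormedSpace ℝ E]
    [MetricSpace Θ] [CompactSpace Θ] [Nonempty Θ]
    [MetricSpace Z] [Nonempty Z]
    (X : Set E) (hXcomp : IsCompact X) (hXconv : Convex ℝ X) (hXne : X.Nonempty)
    (c : E → Θ → ℝ)
    (hc : ContinuousOn (fun p : E × Θ => c p.1 p.2) (X ×ˢ univ))
    (hcconv : ∀ θ : Θ, StrictConvexOn ℝ X fun x => c x θ)
    (ℓ : ℝ → ℝ) (hℓcont : Continuous ℓ) (hℓmono : StrictMono ℓ)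
    (hℓbij : Function.Bijective ℓ) (hℓ0 : ℓ 0 = 0)
    (linv : ℝ → ℝ) (hlinv : ∀ y, ℓ (linv y) = y) (hlinv' : ∀ y, linv (ℓ y) = y)
    (r : ℝ) (hr : 0 < r)
    (I : Θ → Z → ℝ≥0∞)
    (hI1 : ∀ z : Z, ∃ θ : Θ, I θ z ≠ ∞)
    (hI2 : LowerSemicontinuous fun p : Θ × Z => I p.1 p.2)
    (hI3 : ∀ (θ : Θ) (z : Z), I θ z ≠ ∞ → ∀ zs : ℕ → Z, Tendsto zs atTop (𝓝 z) →
      ∃ θs : ℕ → Θ, Tendsto θs atTop (𝓝 θ) ∧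
        Tendsto (fun n => I (θs n) (zs n)) atTop (𝓝 (I θ z)))
    (Xstar : Z → E)
    (hXstar : ∀ z : Z, Xstar z ∈ X ∧
      ∀ y ∈ X, Gfn c X linv r I (Xstar z) z ≤ Gfn c X linv r I y z)
    (Zinf : Θ → Z)
    (hfin : ∀ θ : Θ, I θ (Zinf θ) ≠ ∞)
    (hzero : ∀ θ : Θ,
      ustarFn c X linv r I (Zinf θ) + linv ((I θ (Zinf θ)).toReal - r) = 0) :
    ∀ θ : Θ, regretFn c X (Xstar (Zinf θ)) θ = 0 := by
  intro θ
  have hcomp : IsCompact (X ×ˢ (univ : Set Θ)) := hXcomp.prod isCompact_univ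
  obtain ⟨m, hm⟩ := hcomp.bddBelow_image hc
  obtain ⟨M, hM⟩ := hcomp.bddAbove_image hc
  have hm' (y) (hy : y ∈ X) (θ' : Θ) : m ≤ c y θ' :=
    hm (mem_image_of_mem (fun p : E × Θ => c p.1 p.2) (mk_mem_prod hy (mem_univ θ')))
  have hM' (y) (hy : y ∈ X) (θ' : Θ) : c y θ' ≤ M :=
    hM (mem_image_of_mem (fun p : E × Θ => c p.1 p.2) (mk_mem_prod hy (mem_univ θ')))
  have hlinvmono : Monotone linv := fun a b hab =>
    hℓmono.le_iff_le.1 (by rwa [hlinv, hlinv])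
  obtain ⟨hxX, hmin⟩ := hXstar (Zinf θ)
  have hG : ustarFn c X linv r I (Zinf θ) = Gfn c X linv r I (Xstar (Zinf θ)) (Zinf θ) := by
    refine IsLeast.csInf_eq ⟨mem_image_of_mem _ hxX, ?_⟩
    rintro _ ⟨y, hy, rfl⟩
    exact hmin y hy
  have hle := regretFn_sub_le_Gfn hlinvmono r I
    (fun θ' => regretFn_le (fun y hy => hm' y hy θ') (hM' _ hxX θ') hxX) (hfin θ)
  have hbdd : BddBelow ((fun y => c y θ) '' X) := by
    refine ⟨m, ?_⟩
    rintro _ ⟨y, hy, rfl⟩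
    exact hm' y hy θ
  refine le_antisymm ?_ (regretFn_nonneg hbdd hxX)
  linarith [hzero θ]

end
end

section
/- (Consistency-gap bound for the linear penalty.) Under the general setting with Assumption 1, let the penalty satisfy ℓ⁻¹(y) = β·y for some fixed β > 0, let Z_∞ : Θ → Z satisfy I_θ(Z_∞(θ)) = 0 for all θ ∈ Θ, and define Γ(θ) := R(X*(Z_∞(θ)), θ). Then for every θ ∈ Θ, 0 ≤ Γ(θ) ≤ sup_{x∈X} { max_{θ'∈Θ} { R(x,θ') − β·I_{θ'}(Z_∞(θ)) } − R(x,θ) }. -/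
open Filter Topology Set
open scoped ENNReal Classical

noncomputable section

section Regret

variable {E Θ Z : Type*} [TopologicalSpace E] [TopologicalSpace Θ] {X : Set E} {c : E → Θ → ℝ}

lemma continuousOn_cost_left (hc : ContinuousOn (fun p : E × Θ => c p.1 p.2) (X ×ˢ univ))
    (θ : Θ) : ContinuousOn (fun x => c x θ) X :=
  hc.comp (f := fun x : E => (x, θ)) (by fun_prop) fun _ hx => ⟨hx, mem_univ _⟩

lemma regretFn_nonneg_s11 (hX : IsCompact X)
    (hc : ContinuousOn (fun p : E × Θ => c p.1 p.2) (X ×ˢ univ)) {x : E} (hx : x ∈ X) (θ : Θ) :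
    0 ≤ regretFn c X x θ :=
  sub_nonneg.2 <| csInf_le (hX.image_of_continuousOn (continuousOn_cost_left hc θ)).bddBelow
    (mem_image_of_mem _ hx)

lemma exists_regretFn_eq_zero (hX : IsCompact X) (hne : X.Nonempty)
    (hc : ContinuousOn (fun p : E × Θ => c p.1 p.2) (X ×ˢ univ)) (θ : Θ) :
    ∃ x ∈ X, regretFn c X x θ = 0 := by
  obtain ⟨x, hx, h⟩ := hX.exists_sInf_image_eq hne (continuousOn_cost_left hc θ)
  exact ⟨x, hx, sub_eq_zero.2 h.symm⟩

lemma exists_regretFn_le [CompactSpace Θ] (hX : IsCompact X) (hne : X.Nonempty)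
    (hc : ContinuousOn (fun p : E × Θ => c p.1 p.2) (X ×ˢ univ)) :
    ∃ C : ℝ, ∀ x ∈ X, ∀ θ, regretFn c X x θ ≤ C := by
  obtain ⟨C, hC⟩ := (hX.prod isCompact_univ).exists_bound_of_continuousOn hc
  have habs : ∀ x ∈ X, ∀ θ, |c x θ| ≤ C := fun x hx θ => hC (x, θ) ⟨hx, mem_univ _⟩
  refine ⟨C + C, fun x hx θ => ?_⟩
  have hinf : -C ≤ sInf ((fun y => c y θ) '' X) :=
    le_csInf (hne.image _) <| forall_mem_image.2 fun y hy => (abs_le.1 (habs y hy θ)).1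
  have hx' := (abs_le.1 (habs x hx θ)).2
  unfold regretFn
  linarith

/-- For a monotone inverse penalty, the supremum defining `Gfn` is a real number. -/
lemma coe_Gfn [CompactSpace Θ] (hX : IsCompact X) (hne : X.Nonempty)
    (hc : ContinuousOn (fun p : E × Θ => c p.1 p.2) (X ×ˢ univ)) {linv : ℝ → ℝ}
    (hlinv : Monotone linv) (r : ℝ) {I : Θ → Z → ℝ≥0∞} {z : Z} (hI : ∃ θ, I θ z ≠ ∞)
    {x : E} (hx : x ∈ X) :
    (Gfn c X linv r I x z : EReal) = ⨆ θ, innerFn c X linv r I x θ z := by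
  refine EReal.coe_toReal (ne_of_lt ?_) (ne_of_gt ?_)
  · obtain ⟨C, hC⟩ := exists_regretFn_le hX hne hc
    refine (iSup_le fun θ => ?_).trans_lt (EReal.coe_lt_top (C - linv (-r)))
    unfold innerFn
    split_ifs
    · exact bot_le
    · exact EReal.coe_le_coe_iff.2 <| sub_le_sub (hC x hx θ) <| hlinv <| by
        linarith [ENNReal.toReal_nonneg (a := I θ z)]
  · obtain ⟨θ, hθ⟩ := hI
    refine lt_of_lt_of_le ?_ (le_iSup _ θ)
    rw [innerFn, if_neg hθ]
    exact EReal.bot_lt_coe _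

end Regret

/-- consistency-gap bound for the linear penalty `ℓ⁻¹(y) = β·y`: if
`I_θ(Z_∞(θ)) = 0` for all `θ`, then for every `θ ∈ Θ`,
`0 ≤ Γ(θ) ≤ sup_{x∈X} { max_{θ'∈Θ} { R(x,θ') − β·I_{θ'}(Z_∞(θ)) } − R(x,θ) }`,
where `Γ(θ) := R(X*(Z_∞(θ)),θ)` and the inner maximand is `−∞` when
`I_{θ'}(Z_∞(θ)) = ∞`. -/
theorem consistency_gap_bound_linear_penalty
    {E Θ Z : Type*} [NormedAddCommGroup E] [NormedSpace ℝ E]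
    [MetricSpace Θ] [CompactSpace Θ] [Nonempty Θ]
    [MetricSpace Z] [Nonempty Z]
    (X : Set E) (hXcomp : IsCompact X) (hXconv : Convex ℝ X) (hXne : X.Nonempty)
    (c : E → Θ → ℝ)
    (hc : ContinuousOn (fun p : E × Θ => c p.1 p.2) (X ×ˢ univ))
    (hcconv : ∀ θ : Θ, StrictConvexOn ℝ X fun x => c x θ)
    (ℓ : ℝ → ℝ) (hℓcont : Continuous ℓ) (hℓmono : StrictMono ℓ)
    (hℓbij : Function.Bijective ℓ) (hℓ0 : ℓ 0 = 0)
    (linv : ℝ → ℝ) (hlinv : ∀ y, ℓ (linv y) = y) (hlinv' : ∀ y, linv (ℓ y) = y)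
    (r : ℝ) (hr : 0 < r)
    (I : Θ → Z → ℝ≥0∞)
    (hI1 : ∀ z : Z, ∃ θ : Θ, I θ z ≠ ∞)
    (hI2 : LowerSemicontinuous fun p : Θ × Z => I p.1 p.2)
    (hI3 : ∀ (θ : Θ) (z : Z), I θ z ≠ ∞ → ∀ zs : ℕ → Z, Tendsto zs atTop (𝓝 z) →
      ∃ θs : ℕ → Θ, Tendsto θs atTop (𝓝 θ) ∧
        Tendsto (fun n => I (θs n) (zs n)) atTop (𝓝 (I θ z)))
    (β : ℝ) (hβ : 0 < β) (hlin : ∀ y : ℝ, linv y = β * y)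
    (Xstar : Z → E)
    (hXstar : ∀ z : Z, Xstar z ∈ X ∧
      ∀ y ∈ X, Gfn c X linv r I (Xstar z) z ≤ Gfn c X linv r I y z)
    (Zinf : Θ → Z)
    (hI0 : ∀ θ : Θ, I θ (Zinf θ) = 0) :
    ∀ θ : Θ,
      0 ≤ regretFn c X (Xstar (Zinf θ)) θ ∧
      ((regretFn c X (Xstar (Zinf θ)) θ : ℝ) : EReal) ≤
        ⨆ x : X,
          ((⨆ θ' : Θ, if I θ' (Zinf θ) = ∞ then (⊥ : EReal)
              else ((regretFn c X (x : E) θ' - β * (I θ' (Zinf θ)).toReal : ℝ) : EReal))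
            - ((regretFn c X (x : E) θ : ℝ) : EReal)) := by
  intro θ
  have hmono : Monotone linv := fun a b hab => by
    simpa only [hlin] using mul_le_mul_of_nonneg_left hab hβ.le
  obtain ⟨hmem, hmin⟩ := hXstar (Zinf θ)
  refine ⟨regretFn_nonneg_s11 hXcomp hc hmem θ, ?_⟩
  obtain ⟨x, hx, hx0⟩ := exists_regretFn_eq_zero hXcomp hXne hc θ
  refine le_iSup_of_le ⟨x, hx⟩ ?_
  rw [hx0, EReal.coe_zero, sub_zero]
  have hlower : ((regretFn c X (Xstar (Zinf θ)) θ + β * r : ℝ) : EReal) ≤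
      Gfn c X linv r I (Xstar (Zinf θ)) (Zinf θ) := by
    rw [coe_Gfn hXcomp hXne hc hmono r (hI1 _) hmem]
    refine le_iSup_of_le θ ?_
    rw [innerFn, if_neg (by simp [hI0]), hI0, hlin]
    exact EReal.coe_le_coe_iff.2 (by simp)
  have hle := hlower.trans (EReal.coe_le_coe_iff.2 (hmin x hx))
  rw [coe_Gfn hXcomp hXne hc hmono r (hI1 _) hx] at hle
  rw [← add_sub_cancel_right (regretFn c X (Xstar (Zinf θ)) θ) (β * r), EReal.coe_sub]
  refine EReal.sub_le_of_le_add (hle.trans (iSup_le fun θ' => ?_))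
  unfold innerFn
  split_ifs with h
  · exact bot_le
  · refine le_trans ?_ (add_le_add_left (le_iSup _ θ') _)
    rw [if_neg h, ← EReal.coe_add, hlin]
    exact EReal.coe_le_coe_iff.2 (by linarith)

end
end
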